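/- arXiv:math/0210002 — 4 statements merged into one kernel-verified Lean document; each statement's English description precedes it below -/
import Mathlib

section
/- Let (R, m) be a commutative Noetherian local ring and M a finitely generated R-module of Krull dimension d. Then d ≤ 1 if and only if there exists a non-negative integer t such that μ(N) ≤ t for every R-submodule N of M. -/
open IsLocalRing Module

section Length

variable {R M : Type*} [CommRing R] [AddCommGroup M] [Module R M]

/-- The length of `M ⧸ I N` is the sum of the lengths of `N ⧸ I N` and `M ⧸ N`. -/
lemma Module.length_quotient_smul (I : Ideal R) (N : Submodule R M) :
    length R (M ⧸ I • N) = length R (N ⧸ I • (⊤ : Submodule R N)) + length R (M ⧸ N) := by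
  have hle : I • N ≤ N := Submodule.smul_le_right
  have hmap : (I • (⊤ : Submodule R N)).map N.subtype = I • N := by
    rw [Submodule.map_smul'', Submodule.map_top, Submodule.range_subtype]
  have hcomap : I • (⊤ : Submodule R N) = (I • N).comap N.subtype := by
    rw [← hmap, Submodule.comap_map_eq_of_injective N.injective_subtype]
  refine length_eq_add_of_exact (Submodule.mapQ _ _ N.subtype hcomap.le) (Submodule.factor hle)
    ?_ (Submodule.factor_surjective hle) ?_
  · rw [← LinearMap.ker_eq_bot, Submodule.ker_mapQ, ← hcomap, Submodule.mkQ_map_self]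
  · rw [LinearMap.exact_iff, Submodule.factor, Submodule.ker_mapQ, Submodule.range_mapQ,
      Submodule.range_subtype, Submodule.comap_id]

/-- The length of the fibre `N ⧸ m N` is the minimal number of generators of `N`. -/
lemma IsLocalRing.length_quotient_maximalIdeal_smul_top [IsLocalRing R] {N : Submodule R M}
    (hN : N.FG) :
    length R (N ⧸ maximalIdeal R • (⊤ : Submodule R N)) = N.spanFinrank := by
  let : Field (R ⧸ maximalIdeal R) := Ideal.Quotient.field _
  have : Module.Finite R N := Module.Finite.iff_fg.mpr hN
  have : Module.Finite (R ⧸ maximalIdeal R) (N ⧸ maximalIdeal R • (⊤ : Submodule R N)) :=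
    Module.Finite.of_restrictScalars_finite R _ _
  rw [spanFinrank_eq_finrank_quotient N hN,
    length_eq_of_surjective (R := R ⧸ maximalIdeal R) (S := R) Ideal.Quotient.mk_surjective,
    length_eq_finrank]

end Length

section Domain

variable {A : Type*} [CommRing A]

lemma Ideal.isMaximal_of_isMaximal_comap_of_surjective {B : Type*} [CommRing B] (P : Ideal B)
    {f : A →+* B} (hf : Function.Surjective f) (hP : (P.comap f).IsMaximal) : P.IsMaximal := by
  have hmap := P.map_comap_of_surjective f hf
  rw [← hmap]
  refine (Ideal.map_eq_top_or_isMaximal_of_surjective f hf hP).resolve_left fun h ↦ ?_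
  exact hP.ne_top (by rw [← hmap, h, Ideal.comap_top])

/-- For a nonzerodivisor `x` of a domain, `N ⧸ x N` has the same length as `A ⧸ x A`, provided
that `A ⧸ N` has finite length. -/
lemma Ideal.length_quotient_span_singleton_smul_top [IsDomain A] {x : A} (hx : x ≠ 0) {N : Ideal A}
    (hN : length A (A ⧸ N) ≠ ⊤) :
    length A (N ⧸ Ideal.span {x} • (⊤ : Submodule A N)) = length A (A ⧸ Ideal.span {x}) := by
  have hle : Ideal.span {x} • N ≤ Ideal.span {x} := Ideal.mul_le_left
  have hcomap : N = Submodule.comap (LinearMap.mulLeft A x) (Ideal.span {x} • N) := by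
    ext a
    simp [Ideal.mem_span_singleton_mul, hx]
  have hexact : length A (A ⧸ Ideal.span {x} • N) =
      length A (A ⧸ N) + length A (A ⧸ Ideal.span {x}) := by
    refine length_eq_add_of_exact (Submodule.mapQ _ _ (LinearMap.mulLeft A x) hcomap.le)
      (Submodule.factor hle) ?_ (Submodule.factor_surjective hle) ?_
    · rw [← LinearMap.ker_eq_bot, Submodule.ker_mapQ, ← hcomap, Submodule.mkQ_map_self]
    · rw [LinearMap.exact_iff, Submodule.factor, Submodule.ker_mapQ, Submodule.range_mapQ,
        Submodule.comap_id]
      congr 1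
      ext a
      simp [Ideal.mem_span_singleton', mul_comm]
  rw [length_quotient_smul, add_comm] at hexact
  exact (ENat.add_right_injective_of_ne_top hN) hexact

lemma Ideal.length_quotient_ne_top_of_krullDimLE_one [IsNoetherianRing A] [IsDomain A]
    [Ring.KrullDimLE 1 A] {N : Ideal A} (hN : N ≠ ⊥) : length A (A ⧸ N) ≠ ⊤ := by
  have : Ring.KrullDimLE 0 (A ⧸ N) := .mk₀ fun P hP ↦ by
    have hne : P.comap (Ideal.Quotient.mk N) ≠ ⊥ := fun h ↦ hN <| by
      rw [eq_bot_iff, ← h, ← Ideal.map_le_iff_le_comap, Ideal.map_quotient_self]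
      exact bot_le
    have hmax := (P.comap (Ideal.Quotient.mk N)).isMaximal_of_isPrime_of_ne_bot hne
    exact P.isMaximal_of_isMaximal_comap_of_surjective Ideal.Quotient.mk_surjective hmax
  have : IsArtinianRing (A ⧸ N) := IsNoetherianRing.isArtinianRing_of_krullDimLE_zero
  rw [length_eq_of_surjective (R := A ⧸ N) Ideal.Quotient.mk_surjective]
  exact length_ne_top

/-- The ideals of a Noetherian local domain of dimension at most one have a bounded number of
generators. -/
lemma exists_spanFinrank_ideal_le_of_krullDimLE_one [IsNoetherianRing A] [IsLocalRing A]
    [IsDomain A] [Ring.KrullDimLE 1 A] : ∃ t : ℕ, ∀ N : Ideal A, N.spanFinrank ≤ t := by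
  by_cases hA : IsField A
  · let := hA.toField
    refine ⟨1, fun N ↦ ?_⟩
    rcases Ideal.eq_bot_or_top N with rfl | rfl
    · simp
    · rw [← Ideal.span_singleton_one]
      exact (Submodule.spanFinrank_span_le_ncard_of_finite (Set.finite_singleton _)).trans (by simp)
  obtain ⟨x, hxm, hx⟩ := (Submodule.ne_bot_iff _).mp (isField_iff_maximalIdeal_eq.not.mp hA)
  have hfin := Ideal.length_quotient_ne_top_of_krullDimLE_one
    (mt Ideal.span_singleton_eq_bot.mp hx)
  obtain ⟨t, ht⟩ := ENat.ne_top_iff_exists.mp hfin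
  refine ⟨t, fun N ↦ ?_⟩
  by_cases hN : N = ⊥
  · simp [hN]
  have hle : Ideal.span {x} • (⊤ : Submodule A N) ≤ maximalIdeal A • ⊤ :=
    Submodule.smul_mono_left ((Ideal.span_singleton_le_iff_mem _).mpr hxm)
  have := length_le_of_surjective (Submodule.factor hle) (Submodule.factor_surjective hle)
  rw [length_quotient_maximalIdeal_smul_top N.fg_of_isNoetherianRing,
    Ideal.length_quotient_span_singleton_smul_top hx
      (Ideal.length_quotient_ne_top_of_krullDimLE_one hN), ← ht] at this
  exact_mod_cast this

/-- A sequence of submodules whose quotients have bounded length repeats a value. -/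
lemma Submodule.exists_eq_succ_of_length_quotient_le {R M : Type*} [CommRing R] [AddCommGroup M]
    [Module R M] {J : ℕ → Submodule R M} (hJ : Antitone J) {b : ℕ}
    (hb : ∀ n, length R (M ⧸ J n) ≤ b) : ∃ n, J (n + 1) = J n := by
  by_contra! h
  have hn : ∀ n : ℕ, (n : ℕ∞) ≤ length R (M ⧸ J n) := by
    intro n
    induction n with
    | zero => simp
    | succ n ih =>
      rw [length_quotient] at ih ⊢
      push_cast
      exact (add_le_add_left ih 1).trans
        (Order.coheight_add_one_le ((hJ n.le_succ).lt_of_ne (h n)))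
  have := (hn (b + 1)).trans (hb _)
  norm_cast at this
  omega

/-- By the Artin–Rees lemma, `I ^ n : x` is contained in `I ^ (n - k)` for some fixed `k`. -/
lemma Ideal.exists_comap_mulLeft_pow_le [IsNoetherianRing A] [IsDomain A] (I : Ideal A) {x : A}
    (hx : x ≠ 0) : ∃ k : ℕ, ∀ n ≥ k,
      Submodule.comap (LinearMap.mulLeft A x) (I ^ n) ≤ I ^ (n - k) := by
  obtain ⟨k, hk⟩ := I.exists_pow_inf_eq_pow_smul (Ideal.span {x})
  refine ⟨k, fun n hn a ha ↦ ?_⟩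
  have hmem : x * a ∈ I ^ n • (⊤ : Ideal A) ⊓ Ideal.span {x} :=
    ⟨by simpa using ha, Ideal.mul_mem_right _ _ (Ideal.mem_span_singleton_self x)⟩
  rw [hk n hn] at hmem
  have : x * a ∈ I ^ (n - k) * Ideal.span {x} :=
    Submodule.smul_mono le_rfl inf_le_right hmem
  obtain ⟨b, hb, hab⟩ := Ideal.mem_mul_span_singleton.mp this
  rw [mul_comm b x] at hab
  exact mul_left_cancel₀ hx hab ▸ hb

lemma length_quotient_maximalIdeal_pow_add_le [IsNoetherianRing A] [IsLocalRing A] {t : ℕ}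
    (ht : ∀ N : Ideal A, N.spanFinrank ≤ t) (n k : ℕ) :
    length A (A ⧸ maximalIdeal A ^ (n + k)) ≤ length A (A ⧸ maximalIdeal A ^ n) + k * t := by
  induction k with
  | zero => simp
  | succ k ih =>
    rw [← add_assoc, pow_succ', ← smul_eq_mul, length_quotient_smul,
      length_quotient_maximalIdeal_smul_top (IsNoetherian.noetherian _)]
    calc _ ≤ (t : ℕ∞) + (length A (A ⧸ maximalIdeal A ^ n) + k * t) :=
          add_le_add (by exact_mod_cast ht _) ih
      _ = _ := by push_cast; ring

/-- If the ideals of a Noetherian local domain have a bounded number of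
generators, then the lengths of the `A ⧸ (x, m ^ n)` are bounded for `x ≠ 0`. -/
lemma exists_length_quotient_span_sup_pow_le [IsNoetherianRing A] [IsLocalRing A] [IsDomain A]
    {t : ℕ} (ht : ∀ N : Ideal A, N.spanFinrank ≤ t) {x : A} (hx : x ≠ 0) :
    ∃ b : ℕ, ∀ n, length A (A ⧸ Ideal.span {x} ⊔ maximalIdeal A ^ n) ≤ b := by
  obtain ⟨k, hk⟩ := (maximalIdeal A).exists_comap_mulLeft_pow_le hx
  refine ⟨k * t, fun n ↦ ?_⟩
  set m := maximalIdeal A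
  have hfin : length A (A ⧸ m ^ n) ≠ ⊤ := by
    have := length_quotient_maximalIdeal_pow_add_le ht 0 n
    rw [zero_add, pow_zero, Ideal.one_eq_top, length_eq_zero (M := A ⧸ (⊤ : Ideal A)),
      zero_add] at this
    exact ne_top_of_le_ne_top (by exact_mod_cast ENat.natCast_ne_top (n * t)) this
  have hle : m ^ (n + k) ≤ Ideal.span {x} ⊔ m ^ (n + k) := le_sup_right
  have hexact : length A (A ⧸ m ^ (n + k)) =
      length A (A ⧸ Submodule.comap (LinearMap.mulLeft A x) (m ^ (n + k))) +
        length A (A ⧸ Ideal.span {x} ⊔ m ^ (n + k)) := by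
    refine length_eq_add_of_exact (Submodule.mapQ _ _ (LinearMap.mulLeft A x) le_rfl)
      (Submodule.factor hle) ?_ (Submodule.factor_surjective hle) ?_
    · rw [← LinearMap.ker_eq_bot, Submodule.ker_mapQ, Submodule.mkQ_map_self]
    · have hrange : LinearMap.range (LinearMap.mulLeft A x) = Ideal.span {x} := by
        ext a
        simp [Ideal.mem_span_singleton', mul_comm]
      rw [LinearMap.exact_iff, Submodule.factor, Submodule.ker_mapQ, Submodule.range_mapQ,
        Submodule.comap_id, hrange, Submodule.map_sup, Submodule.mkQ_map_self, sup_bot_eq]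
  have hcolon : length A (A ⧸ m ^ n) ≤
      length A (A ⧸ Submodule.comap (LinearMap.mulLeft A x) (m ^ (n + k))) := by
    have h := hk (n + k) (Nat.le_add_left k n)
    rw [Nat.add_sub_cancel] at h
    exact length_le_of_surjective (Submodule.factor h) (Submodule.factor_surjective h)
  have hmono : Ideal.span {x} ⊔ m ^ (n + k) ≤ Ideal.span {x} ⊔ m ^ n :=
    sup_le_sup_left (Ideal.pow_le_pow_right (Nat.le_add_right n k)) _
  refine (length_le_of_surjective (Submodule.factor hmono)
    (Submodule.factor_surjective hmono)).trans ?_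
  refine (ENat.add_le_add_iff_left hfin).mp ?_
  calc _ ≤ length A (A ⧸ m ^ (n + k)) := hexact ▸ add_le_add_left hcolon _
    _ ≤ _ := by exact_mod_cast length_quotient_maximalIdeal_pow_add_le ht n k

/-- A Noetherian local domain whose ideals have a bounded number of generators has dimension at
most one. -/
lemma ringKrullDim_le_one_of_spanFinrank_ideal_le [IsNoetherianRing A] [IsLocalRing A] [IsDomain A]
    {t : ℕ} (ht : ∀ N : Ideal A, N.spanFinrank ≤ t) : ringKrullDim A ≤ 1 := by
  by_cases hA : IsField A
  · exact (ringKrullDim_eq_zero_of_isField hA).trans_le zero_le_one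
  obtain ⟨x, hxm, hx⟩ := (Submodule.ne_bot_iff _).mp (isField_iff_maximalIdeal_eq.not.mp hA)
  obtain ⟨b, hb⟩ := exists_length_quotient_span_sup_pow_le ht hx
  obtain ⟨n, hn⟩ := Submodule.exists_eq_succ_of_length_quotient_le
    (fun _ _ h ↦ sup_le_sup_left (Ideal.pow_le_pow_right h) _) hb
  have hpow : maximalIdeal A ^ n ≤ Ideal.span {x} := by
    refine Submodule.le_of_le_smul_of_le_jacobson_bot (I := maximalIdeal A)
      (IsNoetherian.noetherian _) (IsLocalRing.jacobson_eq_maximalIdeal _ bot_ne_top).ge ?_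
    rw [smul_eq_mul, ← pow_succ', hn]
    exact le_sup_right
  have hmin : maximalIdeal A ∈ (Ideal.span {x}).minimalPrimes :=
    ⟨⟨inferInstance, (Ideal.span_singleton_le_iff_mem _).mpr hxm⟩,
      fun P hP _ ↦ hP.1.le_of_pow_le (hpow.trans hP.2)⟩
  rw [← maximalIdeal_height_eq_ringKrullDim]
  exact_mod_cast Ideal.height_le_one_of_isPrincipal_of_mem_minimalPrimes _ _ hmin

end Domain

section Transfer

variable {R : Type*} [CommRing R]

/-- The minimal number of generators does not change along a surjection of rings. -/
lemma Submodule.spanFinrank_restrictScalars_of_surjective {S M : Type*} [CommRing S] [Algebra R S]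
    [AddCommGroup M] [Module R M] [Module S M] [IsScalarTower R S M]
    (hsurj : Function.Surjective (algebraMap R S)) (N : Submodule S M) :
    (N.restrictScalars R).spanFinrank = N.spanFinrank := by
  rw [spanFinrank, spanRank_restrictScalars_eq hsurj, spanFinrank]

/-- The dimension of `R ⧸ I` is at most one if this holds for all minimal primes over `I`. -/
lemma ringKrullDim_quotient_le_one_of_minimalPrimes {I : Ideal R}
    (h : ∀ P ∈ I.minimalPrimes, ringKrullDim (R ⧸ P) ≤ 1) : ringKrullDim (R ⧸ I) ≤ 1 := by
  refine Ring.krullDimLE_iff (n := 1).mp (.mk₁ fun Q hQ ↦ or_iff_not_imp_right.mpr fun hmax ↦ ?_)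
  have hIQ : I ≤ Q.comap (Ideal.Quotient.mk I) := by
    rw [← Ideal.map_le_iff_le_comap, Ideal.map_quotient_self]
    exact bot_le
  obtain ⟨P, hP, hPQ⟩ := Ideal.exists_minimalPrimes_le hIQ
  have := hP.isPrime
  have : Ring.KrullDimLE 1 (R ⧸ P) := Ring.krullDimLE_iff.mpr (h P hP)
  have hQP : Q.comap (Ideal.Quotient.mk I) = P := by
    by_contra hne
    set Q' := (Q.comap (Ideal.Quotient.mk I)).map (Ideal.Quotient.mk P) with hQ'
    have hcomap : Q'.comap (Ideal.Quotient.mk P) = Q.comap (Ideal.Quotient.mk I) := by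
      rw [hQ', Ideal.comap_map_of_surjective _ Ideal.Quotient.mk_surjective,
        ← RingHom.ker_eq_comap_bot, Ideal.mk_ker, sup_eq_left.mpr hPQ]
    have hprime : Q'.IsPrime :=
      Ideal.map_isPrime_of_surjective Ideal.Quotient.mk_surjective (by rwa [Ideal.mk_ker])
    have hbot : Q' ≠ ⊥ := fun hbot ↦ hne <| by
      rw [← hcomap, hbot, ← RingHom.ker_eq_comap_bot, Ideal.mk_ker]
    have := Q'.isMaximal_of_isPrime_of_ne_bot hbot
    have : (Q.comap (Ideal.Quotient.mk I)).IsMaximal :=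
      hcomap ▸ Ideal.comap_isMaximal_of_surjective _ Ideal.Quotient.mk_surjective
    exact hmax (Q.isMaximal_of_isMaximal_comap_of_surjective Ideal.Quotient.mk_surjective this)
  refine ⟨⟨hQ, bot_le⟩, fun Q₁ hQ₁ hle ↦ ?_⟩
  have := hQ₁.1
  rw [← Ideal.comap_le_comap_iff_of_surjective _ Ideal.Quotient.mk_surjective, hQP]
  refine hP.2 ⟨inferInstance, ?_⟩ ((Ideal.comap_mono hle).trans hQP.le)
  rw [← Ideal.map_le_iff_le_comap, Ideal.map_quotient_self]
  exact bot_le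

/-- An extension of modules with bounded numbers of generators of submodules again has this
property. -/
lemma exists_spanFinrank_le_of_exact [IsNoetherianRing R] {M₁ M₂ M₃ : Type*} [AddCommGroup M₁]
    [Module R M₁] [AddCommGroup M₂] [Module R M₂] [AddCommGroup M₃] [Module R M₃]
    [Module.Finite R M₁] [Module.Finite R M₂] {f : M₁ →ₗ[R] M₂} {g : M₂ →ₗ[R] M₃}
    (hfg : Function.Exact f g) (h₁ : ∃ t : ℕ, ∀ N : Submodule R M₁, N.spanFinrank ≤ t)
    (h₃ : ∃ t : ℕ, ∀ N : Submodule R M₃, N.spanFinrank ≤ t) :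
    ∃ t : ℕ, ∀ N : Submodule R M₂, N.spanFinrank ≤ t := by
  classical
  obtain ⟨t₁, h₁⟩ := h₁
  obtain ⟨t₃, h₃⟩ := h₃
  refine ⟨t₁ + t₃, fun N ↦ ?_⟩
  obtain ⟨s, hs, hspan⟩ :=
    (IsNoetherian.noetherian (N.comap f)).exists_span_finset_card_eq_spanFinrank
  obtain ⟨u, hu, huspan⟩ :=
    ((IsNoetherian.noetherian N).map g).exists_span_finset_card_eq_spanFinrank
  have huN : Set.SurjOn g N u := by
    rw [Set.SurjOn, ← Submodule.map_coe, ← huspan]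
    exact Submodule.subset_span
  obtain ⟨v, hvN, hinj, rfl⟩ := Finset.exists_subset_injOn_image_eq_of_surjOn _ _ huN
  have hN : Submodule.span R ((s.image f ∪ v : Finset M₂) : Set M₂) = N := by
    rw [Finset.coe_image, ← Submodule.map_span] at huspan
    rw [Finset.coe_union, Finset.coe_image, Submodule.span_union, ← Submodule.map_span, hspan]
    refine le_antisymm (sup_le (Submodule.map_comap_le f N) (Submodule.span_le.mpr hvN)) ?_
    intro x hx
    obtain ⟨y, hy, hyx⟩ := huspan.ge (Submodule.mem_map_of_mem hx)
    obtain ⟨z, hz⟩ := (hfg (x - y)).mp (by rw [map_sub, hyx, sub_self])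
    rw [← sub_add_cancel x y, ← hz]
    refine Submodule.add_mem_sup (Submodule.mem_map_of_mem ?_) hy
    rw [Submodule.mem_comap, hz]
    exact sub_mem hx (Submodule.span_le.mpr hvN hy)
  rw [← hN]
  refine (Submodule.spanFinrank_span_le_ncard_of_finite (Finset.finite_toSet _)).trans ?_
  rw [Set.ncard_coe_finset]
  exact (Finset.card_union_le _ _).trans (add_le_add
    (Finset.card_image_le.trans (hs.trans_le (h₁ _)))
    ((Finset.card_image_of_injOn hinj).symm.trans_le (hu.trans_le (h₃ _))))

/-- A bound on the numbers of generators of submodules passes to the domain of an injective map. -/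
lemma exists_spanFinrank_le_of_injective {M₁ M₂ : Type*} [AddCommGroup M₁] [Module R M₁]
    [AddCommGroup M₂] [Module R M₂] {f : M₁ →ₗ[R] M₂} (hf : Function.Injective f)
    (h : ∃ t : ℕ, ∀ N : Submodule R M₂, N.spanFinrank ≤ t) :
    ∃ t : ℕ, ∀ N : Submodule R M₁, N.spanFinrank ≤ t :=
  h.imp fun _ ht N ↦ (Submodule.spanFinrank_map_eq_of_injective f hf).symm.trans_le (ht (N.map f))

/-- The submodules of `R ⧸ I` have boundedly many generators if and only if its ideals do. -/
lemma exists_spanFinrank_quotient_le_iff {I : Ideal R} :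
    (∃ t : ℕ, ∀ N : Submodule R (R ⧸ I), N.spanFinrank ≤ t) ↔
      ∃ t : ℕ, ∀ N : Ideal (R ⧸ I), N.spanFinrank ≤ t := by
  have hsurj : Function.Surjective (algebraMap R (R ⧸ I)) := Ideal.Quotient.mk_surjective
  refine exists_congr fun t ↦ ⟨fun h N ↦ ?_, fun h N ↦ ?_⟩
  · exact (Submodule.spanFinrank_restrictScalars_of_surjective hsurj N).symm.trans_le (h _)
  · have := Submodule.spanFinrank_restrictScalars_of_surjective hsurj
      (Submodule.span (R ⧸ I) (N : Set (R ⧸ I)))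
    rw [Submodule.restrictScalars_span _ _ hsurj, Submodule.span_eq] at this
    exact this.trans_le (h _)

end Transfer

section Main

variable {R : Type*} [CommRing R] [IsNoetherianRing R] [IsLocalRing R] {M : Type*}
  [AddCommGroup M] [Module R M] [Module.Finite R M]

lemma exists_spanFinrank_le_of_ringKrullDim_le_one
    (hM : ringKrullDim (R ⧸ annihilator R M) ≤ 1) :
    ∃ t : ℕ, ∀ N : Submodule R M, N.spanFinrank ≤ t := by
  have hanti {I J : Ideal R} (hIJ : I ≤ J) (hI : ringKrullDim (R ⧸ I) ≤ 1) :
      ringKrullDim (R ⧸ J) ≤ 1 :=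
    (ringKrullDim_le_of_surjective (Ideal.Quotient.factor hIJ)
      (Ideal.Quotient.factor_surjective hIJ)).trans hI
  induction ‹Module.Finite R M› using
    IsNoetherianRing.induction_on_isQuotientEquivQuotientPrime R with
  | subsingleton N => exact ⟨0, fun N ↦ by simp [Subsingleton.elim N ⊥]⟩
  | quotient N p e =>
    rw [e.annihilator_eq, Ideal.annihilator_quotient] at hM
    have : Ring.KrullDimLE 1 (R ⧸ p.asIdeal) := Ring.krullDimLE_iff.mpr hM
    have : IsLocalRing (R ⧸ p.asIdeal) := .of_surjective' _ Ideal.Quotient.mk_surjective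
    exact exists_spanFinrank_le_of_injective (f := e.toLinearMap) e.injective
      (exists_spanFinrank_quotient_le_iff.mpr exists_spanFinrank_ideal_le_of_krullDimLE_one)
  | exact N₁ N₂ N₃ f g hf hg hfg h₁ h₃ =>
    exact exists_spanFinrank_le_of_exact hfg
      (h₁ (hanti (f.annihilator_le_of_injective hf) hM))
      (h₃ (hanti (g.annihilator_le_of_surjective hg) hM))

lemma ringKrullDim_le_one_of_exists_spanFinrank_le
    (hM : ∃ t : ℕ, ∀ N : Submodule R M, N.spanFinrank ≤ t) :
    ringKrullDim (R ⧸ annihilator R M) ≤ 1 := by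
  refine ringKrullDim_quotient_le_one_of_minimalPrimes fun P hP ↦ ?_
  obtain ⟨hprime, f, hf⟩ := (isAssociatedPrime_iff_exists_injective_linearMap P M).mp
    (associatedPrimes.minimalPrimes_annihilator_subset_associatedPrimes R M hP)
  have : IsLocalRing (R ⧸ P) := .of_surjective' _ Ideal.Quotient.mk_surjective
  obtain ⟨t, ht⟩ := exists_spanFinrank_quotient_le_iff.mp (exists_spanFinrank_le_of_injective hf hM)
  exact ringKrullDim_le_one_of_spanFinrank_ideal_le ht

end Main


/-- **Theorem 1.** Let `(R, m)` be a commutative Noetherian local ring and `M` a finitely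
generated `R`-module of Krull dimension `d` (the Krull dimension of `R ⧸ Ann M`).
Then `d ≤ 1` if and only if there exists a non-negative integer `t` such that the minimal
number of generators `μ(N)` is at most `t` for every submodule `N` of `M` (equivalently,
every submodule `N` admits a generating set with at most `t` elements). -/
theorem dim_le_one_iff_uniform_bound_on_generators
    {R : Type*} [CommRing R] [IsNoetherianRing R] [IsLocalRing R]
    (M : Type*) [AddCommGroup M] [Module R M] [Module.Finite R M] :
    ringKrullDim (R ⧸ Module.annihilator R M) ≤ 1 ↔
      ∃ t : ℕ, ∀ N : Submodule R M,
        ∃ s : Finset M, s.card ≤ t ∧ Submodule.span R (s : Set M) = N := by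
  refine Iff.trans ⟨exists_spanFinrank_le_of_ringKrullDim_le_one,
    ringKrullDim_le_one_of_exists_spanFinrank_le⟩ (exists_congr fun t ↦ forall_congr' fun N ↦
      ⟨fun h ↦ ?_, ?_⟩)
  · obtain ⟨s, hs, hspan⟩ :=
      (IsNoetherian.noetherian N).exists_span_finset_card_eq_spanFinrank
    exact ⟨s, hs.trans_le h, hspan⟩
  · rintro ⟨s, hs, rfl⟩
    refine (Submodule.spanFinrank_span_le_ncard_of_finite s.finite_toSet).trans ?_
    rwa [Set.ncard_coe_finset]
end

section
/- Let (R, m) be a commutative Noetherian local ring, M a finitely generated R-module of dimension d ≥ 1, and N a submodule of M with depth(M/N) ≥ d − 1. Then for any ideal q of R generated by a system of parameters on M, ℓ(N/qN) ≤ ℓ(M/qM). -/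
open Pointwise

/-- The length `ℓ(M)` of an `R`-module `M` (possibly infinite), defined as the supremum of the
lengths of strictly increasing chains of submodules of `M`. -/
noncomputable def moduleLength (R M : Type*) [CommRing R] [AddCommGroup M] [Module R M] : ℕ∞ :=
  ⨆ s : LTSeries (Submodule R M), (s.length : ℕ∞)

/-- The depth of a module `M` over a local ring `(R, m)`: the supremum of the lengths of
(weakly) regular sequences on `M` consisting of elements of `m`.  For a nonzero finitely
generated module over a Noetherian local ring this is the common length of all maximal
`M`-regular sequences in `m`, and the depth of the zero module is `∞`. -/
noncomputable def moduleDepth (R M : Type*) [CommRing R] [IsLocalRing R]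
    [AddCommGroup M] [Module R M] : ℕ∞ :=
  sSup {n : ℕ∞ | ∃ rs : List R, (∀ r ∈ rs, r ∈ IsLocalRing.maximalIdeal R) ∧
    RingTheory.Sequence.IsWeaklyRegular M rs ∧ (rs.length : ℕ∞) = n}


universe u v w

open RingTheory.Sequence IsLocalRing CategoryTheory Abelian

/-- Coset version of prime avoidance: if no prime of a finite set contains both `x` and `J`, then
some element of the coset `x + J` lies outside all of them. -/
lemma Ideal.exists_add_notMem_of_finite {R : Type*} [CommRing R] {S : Set (Ideal R)}
    (hS : S.Finite) (hprime : ∀ P ∈ S, P.IsPrime) (x : R) (J : Ideal R)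
    (h : ∀ P ∈ S, x ∈ P → ¬ J ≤ P) : ∃ b ∈ J, ∀ P ∈ S, x + b ∉ P := by
  classical
  set T : Set (Ideal R) := {P | Maximal (· ∈ S) P}
  have hTS : T ⊆ S := fun P hP ↦ hP.prop
  have hB : {P ∈ T | x ∉ P}.Finite := (hS.subset hTS).subset (Set.sep_subset _ _)
  have hA : {P ∈ T | x ∈ P}.Finite := (hS.subset hTS).subset (Set.sep_subset _ _)
  obtain ⟨b, hbK, hb⟩ : ∃ b ∈ J ⊓ hB.toFinset.inf id, ∀ P ∈ {P ∈ T | x ∈ P}, b ∉ P := by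
    by_contra! hcon
    obtain ⟨P, hPA, hP⟩ := (Ideal.subset_union_prime_finite hA (f := id) ⊥ ⊥
      (fun P hP _ _ ↦ hprime P (hTS hP.1))).mp
      (fun b hb ↦ by simpa only [Set.mem_iUnion₂, exists_prop, id] using! hcon b hb)
    have hPp := hprime P (hTS hPA.1)
    rcases hPp.inf_le.mp hP with hJ | hinf
    · exact h P (hTS hPA.1) hPA.2 hJ
    · obtain ⟨Q, hQ, hQP⟩ := hPp.inf_le'.mp hinf
      have hQ := hB.mem_toFinset.mp hQ
      exact hQ.2 (hQ.1.eq_of_le (hTS hPA.1) hQP ▸ hPA.2)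
  refine ⟨b, hbK.1, fun P hP hxb ↦ ?_⟩
  obtain ⟨Q, hPQ, hQ⟩ := hS.exists_le_maximal hP
  have hxb : x + b ∈ Q := hPQ hxb
  by_cases hxQ : x ∈ Q
  · exact hb Q ⟨hQ, hxQ⟩ ((Q.add_mem_iff_right hxQ).mp hxb)
  · have hbQ : b ∈ Q := (Finset.inf_le (f := id) (hB.mem_toFinset.mpr ⟨hQ, hxQ⟩)) hbK.2
    exact hxQ ((Q.add_mem_iff_left hbQ).mp hxb)

section

variable {R : Type*} [CommRing R] {M : Type*} [AddCommGroup M] [Module R M]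

lemma Module.length_ker_lsmul_eq_length_quotSMulTop (hM : Module.length R M ≠ ⊤) (y : R) :
    Module.length R (LinearMap.ker (LinearMap.lsmul R M y)) =
      Module.length R (QuotSMulTop y M) := by
  set φ := LinearMap.lsmul R M y
  have h₁ := Module.length_eq_add_of_exact (LinearMap.ker φ).subtype φ.rangeRestrict
    (Submodule.subtype_injective _) φ.surjective_rangeRestrict
    (by rw [LinearMap.exact_iff]; simp)
  have h₂ := Module.length_eq_add_of_exact (LinearMap.range φ).subtype (LinearMap.range φ).mkQ
    (Submodule.subtype_injective _) (Submodule.mkQ_surjective _)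
    (by rw [LinearMap.exact_iff]; simp)
  have h₃ : LinearMap.range φ = y • (⊤ : Submodule R M) := by
    ext z
    simp [φ, Submodule.mem_smul_pointwise_iff_exists]
  rw [h₃] at h₁ h₂
  have hfin : Module.length R (y • (⊤ : Submodule R M) : Submodule R M) ≠ ⊤ := fun h ↦
    hM (by rw [h₂, h, top_add])
  rw [h₂, add_comm] at h₁
  exact (ENat.add_left_injective_of_ne_top hfin h₁).symm

/-- For a submodule `V` of a module `M` of finite length, `ℓ(V/yV) = ℓ(0 :_V y)` is at most
`ℓ(0 :_M y) = ℓ(M/yM)`. -/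
lemma Module.length_quotSMulTop_submodule_le_of_length_ne_top (hM : Module.length R M ≠ ⊤)
    (y : R) (V : Submodule R M) :
    Module.length R (QuotSMulTop y V) ≤ Module.length R (QuotSMulTop y M) := by
  have hV : Module.length R V ≠ ⊤ :=
    ne_top_of_le_ne_top hM (Module.length_le_of_injective V.subtype V.subtype_injective)
  rw [← Module.length_ker_lsmul_eq_length_quotSMulTop hM,
    ← Module.length_ker_lsmul_eq_length_quotSMulTop hV]
  refine Module.length_le_of_injective (V.subtype.restrict (p := LinearMap.ker _)
    (q := LinearMap.ker (LinearMap.lsmul R M y)) fun v hv ↦ ?_) fun v w h ↦ ?_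
  · simpa using congrArg Subtype.val (show y • v = 0 by simpa using hv)
  · exact Subtype.ext (Subtype.ext (congrArg (fun z : LinearMap.ker (LinearMap.lsmul R M y) ↦ (z : M)) h))

lemma QuotSMulTop.isArtinian_pow (y : R) [IsArtinian R (QuotSMulTop y M)] (k : ℕ) :
    IsArtinian R (QuotSMulTop (y ^ k) M) := by
  induction k with
  | zero =>
    have : Subsingleton (QuotSMulTop (y ^ 0) M) :=
      Submodule.Quotient.subsingleton_iff.mpr (by simp)
    infer_instance
  | succ k ih =>
    let f : QuotSMulTop y M →ₗ[R] QuotSMulTop (y ^ (k + 1)) M :=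
      Submodule.mapQ _ _ (LinearMap.lsmul R M (y ^ k)) (by
        rintro _ ⟨m, -, rfl⟩
        exact ⟨m, trivial, by simp [← mul_smul, pow_succ, mul_comm]⟩)
    let g : QuotSMulTop (y ^ (k + 1)) M →ₗ[R] QuotSMulTop (y ^ k) M :=
      Submodule.mapQ _ _ LinearMap.id (by
        rintro _ ⟨m, -, rfl⟩
        exact ⟨y • m, trivial, by simp [← mul_smul, pow_succ, mul_comm]⟩)
    refine isArtinian_of_range_eq_ker f g (le_antisymm ?_ fun z hz ↦ ?_)
    · rintro _ ⟨z, rfl⟩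
      obtain ⟨m, rfl⟩ := Submodule.mkQ_surjective _ z
      exact (Submodule.Quotient.mk_eq_zero _).mpr ⟨m, trivial, rfl⟩
    · obtain ⟨m, rfl⟩ := Submodule.mkQ_surjective _ z
      obtain ⟨m', -, hm'⟩ := (Submodule.Quotient.mk_eq_zero _).mp hz
      exact ⟨Submodule.Quotient.mk m', congrArg (Submodule.mkQ _) hm'⟩

/-- By Artin-Rees, `N/yN` is a quotient of `V/yV` for `V` the image of `N` in `M/yᵏM`, `k` large. -/
lemma Module.length_quotSMulTop_submodule_le [IsNoetherianRing R] [Module.Finite R M] (y : R)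
    (hM : Module.length R (QuotSMulTop y M) ≠ ⊤) (N : Submodule R M) :
    Module.length R (QuotSMulTop y N) ≤ Module.length R (QuotSMulTop y M) := by
  obtain ⟨k, hk⟩ := (Ideal.span {y}).exists_pow_inf_eq_pow_smul N
  replace hk : y ^ (k + 1) • (⊤ : Submodule R M) ⊓ N ≤ y • N := by
    have h := hk (k + 1) (Nat.le_succ k)
    rw [Nat.add_sub_cancel_left, Ideal.span_singleton_pow, pow_one,
      Submodule.ideal_span_singleton_smul] at h
    rw [h, ← Submodule.ideal_span_singleton_smul y N]
    exact smul_mono_right _ inf_le_right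
  have : IsArtinian R (QuotSMulTop y M) :=
    (isFiniteLength_iff_isNoetherian_isArtinian.mp (Module.length_ne_top_iff.mp hM)).2
  have := QuotSMulTop.isArtinian_pow (M := M) y (k + 1)
  set X := QuotSMulTop (y ^ (k + 1)) M
  let π : M →ₗ[R] X := Submodule.mkQ _
  let ψ : N →ₗ[R] N.map π := π.restrict fun n hn ↦ Submodule.mem_map_of_mem hn
  let φ : N →ₗ[R] QuotSMulTop y (N.map π) := Submodule.mkQ _ ∘ₗ ψ
  have hker : LinearMap.ker φ ≤ y • ⊤ := by
    intro n hn
    obtain ⟨⟨_, n', hn', rfl⟩, -, h⟩ := (Submodule.Quotient.mk_eq_zero _).mp hn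
    have h : π (y • n') = π n := congrArg Subtype.val h
    have hmem : (n : M) - y • n' ∈ y ^ (k + 1) • (⊤ : Submodule R M) ⊓ N :=
      ⟨(Submodule.Quotient.eq _).mp h.symm, N.sub_mem n.2 (N.smul_mem _ hn')⟩
    obtain ⟨n'', hn'', h''⟩ := hk hmem
    refine ⟨⟨n', hn'⟩ + ⟨n'', hn''⟩, trivial, Subtype.ext ?_⟩
    have h'' : y • n'' = n - y • n' := h''
    simp [h'']
  calc Module.length R (QuotSMulTop y N)
    _ ≤ Module.length R (N ⧸ LinearMap.ker φ) :=
      Module.length_le_of_surjective _ (Submodule.factor_surjective hker)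
    _ ≤ Module.length R (QuotSMulTop y (N.map π)) :=
      Module.length_le_of_injective (φ.ker.liftQ φ le_rfl)
        (LinearMap.ker_eq_bot.mp (φ.ker.ker_liftQ_eq_bot _ _ le_rfl))
    _ ≤ Module.length R (QuotSMulTop y X) :=
      Module.length_quotSMulTop_submodule_le_of_length_ne_top Module.length_ne_top _ _
    _ ≤ Module.length R (QuotSMulTop y M) :=
      Module.length_le_of_surjective _
        (QuotSMulTop.map_surjective y (f := π) (Submodule.mkQ_surjective _))

end

lemma CategoryTheory.Abelian.subsingleton_ext_quotSMulTop {R : Type u} [CommRing R]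
    [Small.{w} R] {X L : ModuleCat.{w} R} {x : R} (hx : IsSMulRegular L x) {n : ℕ}
    (h : ∀ i < n + 1, Subsingleton (Ext X L i)) :
    ∀ i < n, Subsingleton (Ext X (ModuleCat.of R (QuotSMulTop x L)) i) := by
  intro i hi
  have zero1 := AddCommGrpCat.isZero_of_iff_subsingleton.mpr (h i (by omega))
  have zero2 := AddCommGrpCat.isZero_of_iff_subsingleton.mpr (h (i + 1) (by omega))
  exact AddCommGrpCat.subsingleton_of_isZero <| ShortComplex.Exact.isZero_of_both_zeros
    ((Ext.covariant_sequence_exact₃' X hx.smulShortComplex_shortExact) i (i + 1) rfl)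
    (zero1.eq_zero_of_src _) (zero2.eq_zero_of_tgt _)

lemma exists_add_isSMulRegular {R : Type*} [CommRing R] [IsNoetherianRing R] {L : Type*}
    [AddCommGroup L] [Module R L] [Module.Finite R L] (x : R) (J : Ideal R)
    (h : ∀ P ∈ associatedPrimes R L, x ∈ P → ¬ J ≤ P) :
    ∃ b ∈ J, IsSMulRegular L (x + b) := by
  obtain ⟨b, hb, h⟩ := Ideal.exists_add_notMem_of_finite (associatedPrimes.finite R L)
    (fun P hP ↦ hP.isPrime) x J h
  refine ⟨b, hb, ?_⟩
  by_contra hreg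
  have hreg : x + b ∈ {r : R | IsSMulRegular L r}ᶜ := hreg
  rw [← biUnion_associatedPrimes_eq_compl_regular R] at hreg
  simp only [Set.mem_iUnion₂] at hreg
  obtain ⟨P, hP, hxP⟩ := hreg
  exact h P hP hxP

lemma Module.length_quotSMulTop_le_of_injective {R : Type*} [CommRing R] [IsNoetherianRing R]
    {N M : Type*} [AddCommGroup N] [Module R N] [AddCommGroup M] [Module R M] [Module.Finite R M]
    {i : N →ₗ[R] M} (hi : Function.Injective i) (y : R)
    (hM : Module.length R (QuotSMulTop y M) ≠ ⊤) :
    Module.length R (QuotSMulTop y N) ≤ Module.length R (QuotSMulTop y M) :=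
  (QuotSMulTop.congr y (LinearEquiv.ofInjective i hi)).length_eq.trans_le
    (Module.length_quotSMulTop_submodule_le y hM _)

/-- The inequality `ℓ(N/qN) ≤ ℓ(M/qM)` for `q` generated by `n + 1` elements and a short exact
sequence `0 → N → M → L → 0` with `Ext^j(k, L) = 0` for `j < n`. -/
theorem Module.length_quotient_ofList_smul_top_le {R : Type u} [CommRing R] [IsNoetherianRing R]
    [IsLocalRing R] [Small.{w} R] {n : ℕ} {rs : List R} (hlen : rs.length = n + 1)
    (hrs : ∀ r ∈ rs, r ∈ maximalIdeal R)
    {N M : Type*} {L : Type w} [AddCommGroup N] [Module R N] [AddCommGroup M] [Module R M]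
    [AddCommGroup L] [Module R L] [Module.Finite R M] [Module.Finite R L]
    {i : N →ₗ[R] M} {g : M →ₗ[R] L} (hi : Function.Injective i) (hg : Function.Surjective g)
    (hig : Function.Exact i g)
    (hext : ∀ j < n, Subsingleton (Ext (ModuleCat.of R (Shrink.{w} (R ⧸ maximalIdeal R)))
      (ModuleCat.of R L) j))
    (hprime : ∀ P : Ideal R, P.IsPrime → Module.annihilator R L ≤ P → Ideal.ofList rs ≤ P →
      maximalIdeal R ≤ P)
    (hfin : Module.length R (M ⧸ (Ideal.ofList rs • ⊤ : Submodule R M)) ≠ ⊤) :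
    Module.length R (N ⧸ (Ideal.ofList rs • ⊤ : Submodule R N)) ≤
      Module.length R (M ⧸ (Ideal.ofList rs • ⊤ : Submodule R M)) := by
  induction n generalizing rs N M L with
  | zero =>
    obtain ⟨y, rfl⟩ := List.length_eq_one_iff.mp hlen
    rw [Ideal.ofList_singleton, Submodule.ideal_span_singleton_smul] at hfin ⊢
    rw [Submodule.ideal_span_singleton_smul]
    exact Module.length_quotSMulTop_le_of_injective hi y hfin
  | succ n ih =>
    obtain ⟨x, rs, rfl⟩ := List.exists_cons_of_length_eq_add_one hlen
    obtain ⟨z, hz, hzreg⟩ : ∃ z ∈ maximalIdeal R, IsSMulRegular L z := by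
      have := hext 0 (Nat.succ_pos n)
      have hsub : Subsingleton (Shrink.{w} (R ⧸ maximalIdeal R) →ₗ[R] L) :=
        ((Ext.addEquiv₀ (X := ModuleCat.of R (Shrink.{w} (R ⧸ maximalIdeal R)))
          (Y := ModuleCat.of R L)).trans ModuleCat.homAddEquiv).symm.subsingleton
      obtain ⟨z, hz, hzreg⟩ := IsSMulRegular.subsingleton_linearMap_iff.mp hsub
      refine ⟨z, ?_, hzreg⟩
      rwa [(Shrink.linearEquiv R (R ⧸ maximalIdeal R)).annihilator_eq,
        Ideal.annihilator_quotient] at hz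
    obtain ⟨b, hb, hreg⟩ := exists_add_isSMulRegular (L := L) x (Ideal.ofList rs) (by
      intro P hP hxP hJP
      have hmP := hprime P hP.isPrime
        (by simpa [Submodule.annihilator_top] using hP.annihilator_le) (by
        rw [Ideal.ofList_cons, sup_le_iff, Ideal.span_singleton_le_iff_mem]
        exact ⟨hxP, hJP⟩)
      have : z ∈ ⋃ p ∈ associatedPrimes R L, (p : Set R) := Set.mem_biUnion hP (hmP hz)
      rw [biUnion_associatedPrimes_eq_compl_regular R] at this
      exact this hzreg)
    set y := x + b
    have hlist : Ideal.ofList (x :: rs) = Ideal.ofList (y :: rs) := by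
      rw [Ideal.ofList_cons, Ideal.ofList_cons]
      apply le_antisymm <;> refine sup_le ?_ le_sup_right <;>
        rw [Ideal.span_singleton_le_iff_mem]
      · rw [← add_sub_cancel_right x b]
        exact Ideal.sub_mem _ (Ideal.mem_sup_left (Ideal.mem_span_singleton_self _))
          (Ideal.mem_sup_right hb)
      · exact Ideal.add_mem _ (Ideal.mem_sup_left (Ideal.mem_span_singleton_self _))
          (Ideal.mem_sup_right hb)
    rw [hlist] at hfin hprime ⊢
    rw [(Submodule.quotOfListConsSMulTopEquivQuotSMulTopInner M y rs).length_eq] at hfin ⊢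
    rw [(Submodule.quotOfListConsSMulTopEquivQuotSMulTopInner N y rs).length_eq]
    refine ih (L := QuotSMulTop y L) (i := QuotSMulTop.map y i) (g := QuotSMulTop.map y g)
      (by simpa using hlen) (fun r hr ↦ hrs r (List.mem_cons_of_mem _ hr)) ?_
      (QuotSMulTop.map_surjective y hg) (QuotSMulTop.map_exact y hig hg)
      (subsingleton_ext_quotSMulTop (L := ModuleCat.of R L) hreg hext) ?_ hfin
    · have h0 : Function.Exact (0 : PUnit →ₗ[R] N) i :=
        (LinearMap.exact_zero_iff_injective _ _).mpr hi
      have h1 := QuotSMulTop.map_first_exact_on_four_term_exact_of_isSMulRegular_last h0 hig hreg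
      rw [map_zero] at h1
      exact (LinearMap.exact_zero_iff_injective _ _).mp h1
    · intro P hP hann hle
      refine hprime P hP (le_trans ?_ hann) ?_
      · exact LinearMap.annihilator_le_of_surjective _ (Submodule.mkQ_surjective _)
      · rw [Ideal.ofList_cons, sup_le_iff, Ideal.span_singleton_le_iff_mem]
        exact ⟨hann (QuotSMulTop.mem_annihilator _ y), hle⟩

lemma IsLocalRing.maximalIdeal_le_of_annihilator_le {R : Type*} [CommRing R] [IsLocalRing R]
    {X : Type*} [AddCommGroup X] [Module R X] [IsNoetherian R X] [IsArtinian R X]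
    {P : Ideal R} [P.IsPrime] (hP : Module.annihilator R X ≤ P) : maximalIdeal R ≤ P := by
  intro x hx
  obtain ⟨n, hn⟩ := IsArtinian.monotone_stabilizes (R := R) (M := X)
    ⟨fun n ↦ OrderDual.toDual (x ^ n • (⊤ : Submodule R X)), monotone_nat_of_le_succ fun n ↦ by
      rintro _ ⟨m, -, rfl⟩
      exact ⟨x • m, trivial, by simp [← mul_smul, pow_succ, mul_comm]⟩⟩
  have hn : x ^ n • (⊤ : Submodule R X) = x ^ (n + 1) • (⊤ : Submodule R X) := hn (n + 1) (by omega)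
  have hbot : x ^ n • (⊤ : Submodule R X) = ⊥ :=
    Submodule.eq_bot_of_eq_pointwise_smul_of_mem_jacobson_annihilator (r := x)
      (IsNoetherian.noetherian _) (by rw [← mul_smul, ← pow_succ', ← hn])
      (maximalIdeal_le_jacobson _ hx)
  refine Ideal.IsPrime.mem_of_pow_mem ‹_› n (hP (Module.mem_annihilator.mpr fun m ↦ ?_))
  exact (Submodule.eq_bot_iff _).mp hbot _ ⟨m, trivial, rfl⟩

lemma moduleLength_eq_length (R M : Type*) [CommRing R] [AddCommGroup M] [Module R M] :
    moduleLength R M = Module.length R M := by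
  rw [← WithBot.coe_inj, Module.coe_length, Order.krullDim_eq_iSup_length]
  rfl

lemma subsingleton_ext_of_le_moduleDepth {R : Type u} [CommRing R] [IsNoetherianRing R]
    [IsLocalRing R] [Small.{max u v} R] {L : Type v} [AddCommGroup L] [Module R L]
    [Module.Finite R L] [Nontrivial L] {n : ℕ} (hn : n ≤ moduleDepth R L) :
    ∀ j < n, Subsingleton (Ext (ModuleCat.of R (Shrink.{max u v} (R ⧸ maximalIdeal R)))
      (ModuleCat.of R (ULift.{u} L)) j) := by
  intro j hj
  obtain ⟨_, ⟨rs, hrs, hreg, rfl⟩, hlt⟩ := lt_sSup_iff.mp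
    ((Nat.cast_lt (α := ℕ∞).mpr hj).trans_le hn)
  have : Module.Finite R (Shrink.{max u v} (R ⧸ maximalIdeal R)) :=
    Module.Finite.equiv (Shrink.linearEquiv R (R ⧸ maximalIdeal R)).symm
  refine ModuleCat.subsingleton_ext_of_exists_isRegular (maximalIdeal R)
    (ModuleCat.of R (Shrink.{max u v} (R ⧸ maximalIdeal R))) ?_
    (ModuleCat.of R (ULift.{u} L)) ?_ rs hrs ?_ j (Nat.cast_lt.mp hlt)
  · rw [(Shrink.linearEquiv R (R ⧸ maximalIdeal R)).support_eq, Module.support_eq_zeroLocus,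
      Ideal.annihilator_quotient]
  · exact (Submodule.top_ne_ideal_smul_of_le_jacobson_annihilator
      (maximalIdeal_le_jacobson _)).symm.lt_top
  · rw [isRegular_iff_isWeaklyRegular_of_subset_maximalIdeal hrs]
    exact ((ULift.moduleEquiv (R := R) (M := L)).isWeaklyRegular_congr rs).mpr hreg

lemma length_quotient_ofList_smul_top_le_of_le_moduleDepth {R : Type u} [CommRing R]
    [IsNoetherianRing R] [IsLocalRing R] {M : Type v} [AddCommGroup M] [Module R M]
    [Module.Finite R M] (N : Submodule R M) {n : ℕ} (hn : n ≤ moduleDepth R (M ⧸ N))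
    {rs : List R} (hlen : rs.length = n + 1) (hrs : ∀ r ∈ rs, r ∈ maximalIdeal R)
    (hfin : Module.length R (M ⧸ (Ideal.ofList rs • ⊤ : Submodule R M)) ≠ ⊤) :
    Module.length R (N ⧸ (Ideal.ofList rs • ⊤ : Submodule R N)) ≤
      Module.length R (M ⧸ (Ideal.ofList rs • ⊤ : Submodule R M)) := by
  rcases subsingleton_or_nontrivial (M ⧸ N) with h | h
  · obtain rfl := Submodule.Quotient.subsingleton_iff.mp h
    refine (Submodule.Quotient.equiv _ _ Submodule.topEquiv ?_).length_eq.le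
    exact (Submodule.map_smul'' _ _ _).trans (by rw [Submodule.map_top, LinearEquiv.range])
  obtain ⟨_, _⟩ := isFiniteLength_iff_isNoetherian_isArtinian.mp
    (Module.length_ne_top_iff.mp hfin)
  let e : (M ⧸ N) ≃ₗ[R] ULift.{u} (M ⧸ N) := ULift.moduleEquiv.symm
  refine Module.length_quotient_ofList_smul_top_le hlen hrs (i := N.subtype)
    (g := e.toLinearMap ∘ₗ N.mkQ) N.subtype_injective
    (e.surjective.comp N.mkQ_surjective) ?_
    (subsingleton_ext_of_le_moduleDepth hn) ?_ hfin
  · rw [LinearMap.exact_iff, LinearEquiv.ker_comp, Submodule.ker_mkQ, Submodule.range_subtype]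
  · intro P hP hann hle
    rw [← e.annihilator_eq] at hann
    refine maximalIdeal_le_of_annihilator_le
      (X := M ⧸ (Ideal.ofList rs • ⊤ : Submodule R M)) (P := P) ?_
    refine Module.annihilator_le_of_mem_support (p := ⟨P, hP⟩) ?_
    rw [Module.support_quotient]
    exact ⟨Module.mem_support_iff_of_finite.mpr
      ((LinearMap.annihilator_le_of_surjective _ N.mkQ_surjective).trans hann), hle⟩

/-- **Theorem 3.** Let `(R, m)` be a commutative Noetherian local ring, `M` a finitely
generated `R`-module of dimension `d ≥ 1`, and `N` a submodule of `M` with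
`depth (M/N) ≥ d − 1`.  Then for any ideal `q` of `R` generated by a system of parameters on
`M` (i.e. by `d` elements of `m`, with `ℓ(M/qM)` finite), `ℓ(N/qN) ≤ ℓ(M/qM)`. -/
theorem length_quotient_sop_smul_le
    {R : Type*} [CommRing R] [IsNoetherianRing R] [IsLocalRing R]
    (M : Type*) [AddCommGroup M] [Module R M] [Module.Finite R M]
    (d : ℕ) (hd : 1 ≤ d)
    (hdim : ringKrullDim (R ⧸ Module.annihilator R M) = d)
    (N : Submodule R M)
    (hdepth : ((d - 1 : ℕ) : ℕ∞) ≤ moduleDepth R (M ⧸ N))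
    (q : Ideal R) (f : Fin d → R) (hfm : ∀ i, f i ∈ IsLocalRing.maximalIdeal R)
    (hq : q = Ideal.span (Set.range f))
    (hfin : moduleLength R (M ⧸ (q • ⊤ : Submodule R M)) ≠ ⊤) :
    moduleLength R (N ⧸ (q • ⊤ : Submodule R N)) ≤
      moduleLength R (M ⧸ (q • ⊤ : Submodule R M)) := by
  have hq' : q = Ideal.ofList (List.ofFn f) := by
    rw [hq, Ideal.ofList]
    congr 1
    ext x
    simp
  subst hq'
  rw [moduleLength_eq_length] at hfin ⊢
  rw [moduleLength_eq_length]
  refine length_quotient_ofList_smul_top_le_of_le_moduleDepth N hdepth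
    (by rw [List.length_ofFn]; omega) ?_ hfin
  simpa [List.forall_mem_ofFn_iff] using hfm
end

section
/- Let (R, m) be a commutative Noetherian local ring, M a finitely generated Cohen–Macaulay R-module of dimension d ≥ 1, and N a Cohen–Macaulay submodule of M with dim N = d. Then every M-regular sequence of elements of m is an N-regular sequence. -/
open Pointwise

/-- A finitely generated module `M` over a Noetherian local ring is Cohen–Macaulay if
`depth M = dim M`, where `dim M` is the Krull dimension of `R ⧸ Ann M`. -/
def IsCohenMacaulayModule (R M : Type*) [CommRing R] [IsLocalRing R]
    [AddCommGroup M] [Module R M] : Prop :=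
  (moduleDepth R M : WithBot ℕ∞) = ringKrullDim (R ⧸ Module.annihilator R M)

open RingTheory.Sequence IsLocalRing

section

variable {R : Type*} [CommRing R] [IsNoetherianRing R] [IsLocalRing R]

/-- The module `K` admits a weakly regular sequence of length `n` inside the maximal ideal. -/
def HasWeaklyRegularSequence (R K : Type*) [CommRing R] [IsLocalRing R] [AddCommGroup K]
    [Module R K] (n : ℕ) : Prop :=
  ∃ rs : List R, (∀ r ∈ rs, r ∈ maximalIdeal R) ∧ IsWeaklyRegular K rs ∧ rs.length = n

omit [IsNoetherianRing R] in
/-- If `x` and `y` are regular on `K` and the socle of `K / yK` vanishes, then so does the socle of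
`K / xK`. -/
lemma socle_quotSMulTop_eq_zero {K : Type*} [AddCommGroup K] [Module R K]
    {x y : R} (hym : y ∈ maximalIdeal R)
    (hx : IsSMulRegular K x) (hy : IsSMulRegular K y)
    (h : ∀ k : QuotSMulTop y K, (∀ a ∈ maximalIdeal R, a • k = 0) → k = 0)
    (k : QuotSMulTop x K) (hk : ∀ a ∈ maximalIdeal R, a • k = 0) : k = 0 := by
  obtain ⟨k, rfl⟩ := Submodule.Quotient.mk_surjective _ k
  have key (z : R) (k : K) : (Submodule.Quotient.mk k : QuotSMulTop z K) = 0 ↔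
      ∃ l : K, z • l = k := by
    rw [Submodule.Quotient.mk_eq_zero, Submodule.mem_smul_pointwise_iff_exists]
    simp
  simp_rw [← Submodule.Quotient.mk_smul, key] at hk
  obtain ⟨l, hl⟩ := hk y hym
  have hl0 : (Submodule.Quotient.mk l : QuotSMulTop y K) = 0 := by
    refine h _ fun a ha ↦ ?_
    obtain ⟨t, ht⟩ := hk a ha
    rw [← Submodule.Quotient.mk_smul, key]
    refine ⟨t, hx ?_⟩
    simp only
    rw [smul_comm x y, ht, smul_comm x a, hl, smul_comm]
  obtain ⟨t, rfl⟩ := (key _ _).1 hl0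
  rw [key]
  refine ⟨t, hy ?_⟩
  simp only
  rw [← hl, smul_comm]

lemma exists_mem_maximalIdeal_isSMulRegular_of_socle_eq_zero {K : Type*} [AddCommGroup K]
    [Module R K] [Module.Finite R K]
    (h : ∀ k : K, (∀ a ∈ maximalIdeal R, a • k = 0) → k = 0) :
    ∃ z ∈ maximalIdeal R, IsSMulRegular K z := by
  have hs : Subsingleton ((R ⧸ maximalIdeal R) →ₗ[R] K) := by
    refine ⟨fun f g ↦ ?_⟩
    ext
    rw [← sub_eq_zero]
    refine h _ fun a ha ↦ ?_
    have ha' : a • (1 : R ⧸ maximalIdeal R) = 0 := by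
      rw [Algebra.smul_def, mul_one]
      exact Ideal.Quotient.eq_zero_iff_mem.2 ha
    simp [smul_sub, ← map_smul, ha']
  simpa [Ideal.annihilator_quotient] using IsSMulRegular.subsingleton_linearMap_iff.1 hs

omit [IsNoetherianRing R] in
lemma socle_eq_zero_of_isSMulRegular {K : Type*} [AddCommGroup K] [Module R K] {z : R}
    (hz : z ∈ maximalIdeal R) (h : IsSMulRegular K z) (k : K)
    (hk : ∀ a ∈ maximalIdeal R, a • k = 0) : k = 0 :=
  h.right_eq_zero_of_smul (hk z hz)

/-- Dividing a finite module by a regular element of the maximal ideal decreases the length of a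
weakly regular sequence by at most one. -/
lemma HasWeaklyRegularSequence.quotSMulTop {K : Type*} [AddCommGroup K] [Module R K]
    [Module.Finite R K] {n : ℕ} (hK : HasWeaklyRegularSequence R K (n + 1))
    {x : R} (hxm : x ∈ maximalIdeal R) (hx : IsSMulRegular K x) :
    HasWeaklyRegularSequence R (QuotSMulTop x K) n := by
  induction n generalizing K x with
  | zero => exact ⟨[], by simp, .nil _ _, rfl⟩
  | succ n ih =>
    obtain ⟨rs, hrs, hreg, hlen⟩ := hK
    obtain ⟨y, ys, rfl⟩ := List.exists_cons_of_length_eq_add_one hlen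
    obtain ⟨y', ys, rfl⟩ := List.exists_cons_of_length_eq_add_one (Nat.succ.inj hlen)
    have hym : y ∈ maximalIdeal R := hrs y (by simp)
    have hy'm : y' ∈ maximalIdeal R := hrs y' (by simp)
    obtain ⟨hy, hys⟩ := (isWeaklyRegular_cons_iff ..).1 hreg
    have hy' := ((isWeaklyRegular_cons_iff ..).1 hys).1
    have hsy := socle_eq_zero_of_isSMulRegular hy'm hy'
    have hsx := socle_quotSMulTop_eq_zero hym hx hy hsy
    obtain ⟨z, hzm, hz⟩ := exists_mem_maximalIdeal_isSMulRegular_of_socle_eq_zero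
      (K := QuotSMulTop x K × QuotSMulTop y K) fun k hk ↦ Prod.ext
        (hsx _ fun a ha ↦ congrArg Prod.fst (hk a ha))
        (hsy _ fun a ha ↦ congrArg Prod.snd (hk a ha))
    have hzx : IsSMulRegular (QuotSMulTop x K) z := fun a b hab ↦
      congrArg Prod.fst (@hz (a, 0) (b, 0) (by simpa using hab))
    have hzy : IsSMulRegular (QuotSMulTop y K) z := fun a b hab ↦
      congrArg Prod.snd (@hz (0, a) (0, b) (by simpa using hab))
    have swap {u v : R} {ws : List R} (hu : u ∈ maximalIdeal R) (hv : v ∈ maximalIdeal R)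
        (hw : ∀ r ∈ ws, r ∈ maximalIdeal R) (h : IsWeaklyRegular K (u :: v :: ws)) :
        IsWeaklyRegular K (v :: u :: ws) :=
      isWeaklyRegular_of_perm_of_subset_maximalIdeal h (List.Perm.swap v u ws)
        (by simpa using ⟨hu, hv, hw⟩)
    have hys' : HasWeaklyRegularSequence R (QuotSMulTop y K) (n + 1) :=
      ⟨y' :: ys, fun r hr ↦ hrs r (List.mem_cons_of_mem _ hr), hys, Nat.succ.inj hlen⟩
    obtain ⟨ws, hws, hwreg, hwlen⟩ := ih hys' hzm hzy
    have hKz : HasWeaklyRegularSequence R (QuotSMulTop z K) (n + 1) :=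
      ⟨y :: ws, by simpa using ⟨hym, hws⟩, ((isWeaklyRegular_cons_iff ..).1
        (swap hym hzm hws (.cons hy (.cons hzy hwreg)))).2, by simp [hwlen]⟩
    obtain ⟨hzK, hxz⟩ := (isWeaklyRegular_cons_iff ..).1
      (swap hxm hzm (ws := []) (by simp) (.cons hx (.cons hzx (.nil _ _))))
    replace hxz := (isWeaklyRegular_singleton_iff ..).1 hxz
    obtain ⟨ws', hws', hwreg', hwlen'⟩ := ih hKz hxm hxz
    exact ⟨z :: ws', by simpa using ⟨hzm, hws'⟩, ((isWeaklyRegular_cons_iff ..).1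
      (swap hzm hxm hws' (.cons hzK (.cons hxz hwreg')))).2, by simp [hwlen']⟩

/-- An associated prime of `K` is contained in an associated prime of `K / yK` that contains `y`,
if `y` is regular on `K`. -/
lemma IsAssociatedPrime.exists_le_quotSMulTop {K : Type*} [AddCommGroup K] [Module R K]
    [Module.Finite R K] {p : Ideal R} (hp : IsAssociatedPrime p K) {y : R}
    (hym : y ∈ maximalIdeal R) (hy : IsSMulRegular K y) :
    ∃ q, IsAssociatedPrime q (QuotSMulTop y K) ∧ p ≤ q ∧ y ∈ q := by
  let L : Submodule R K := Submodule.torsionBySet R K p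
  have hL : ∃ k ∈ L, k ∉ y • (⊤ : Submodule R K) := by
    by_contra! hle
    have hLy : L ≤ y • L := by
      intro k hk
      obtain ⟨l, -, rfl⟩ := (Submodule.mem_smul_pointwise_iff_exists ..).1 (hle k hk)
      refine Submodule.smul_mem_pointwise_smul _ _ _ ?_
      rw [Submodule.mem_torsionBySet_iff] at hk ⊢
      intro a
      apply hy.right_eq_zero_of_smul
      rw [smul_comm]
      exact hk a
    have hbot : L = ⊥ := Submodule.eq_bot_of_eq_pointwise_smul_of_mem_jacobson_annihilator
      (IsNoetherian.noetherian L)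
      (le_antisymm hLy (Submodule.smul_le_self_of_tower y L)) (maximalIdeal_le_jacobson _ hym)
    obtain ⟨hpr, k, rfl⟩ := (isAssociatedPrime_iff ..).1 hp
    have hk : k ∈ L := by
      rw [Submodule.mem_torsionBySet_iff]
      exact fun a ↦ Submodule.mem_colon_singleton.1 a.2
    rw [hbot, Submodule.mem_bot] at hk
    exact hpr.ne_top (by simp [hk])
  obtain ⟨k, hk, hky⟩ := hL
  obtain ⟨q, hq, hle⟩ := exists_le_isAssociatedPrime_of_isNoetherianRing R
    (Submodule.Quotient.mk k : QuotSMulTop y K)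
    (by rwa [ne_eq, Submodule.Quotient.mk_eq_zero])
  refine ⟨q, hq, fun a ha ↦ hle ?_, hle ?_⟩
  · rw [Submodule.mem_torsionBySet_iff] at hk
    rw [Submodule.mem_colon_singleton, ← Submodule.Quotient.mk_smul, hk ⟨a, ha⟩]
    simp
  · rw [Submodule.mem_colon_singleton, ← Submodule.Quotient.mk_smul, Submodule.mem_bot,
      Submodule.Quotient.mk_eq_zero]
    exact Submodule.smul_mem_pointwise_smul _ _ _ trivial

/-- The depth of a finite module is at most the dimension of `R / p` for every associated
prime `p`. -/
lemma HasWeaklyRegularSequence.le_coheight {K : Type*} [AddCommGroup K] [Module R K]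
    [Module.Finite R K] {n : ℕ} (hK : HasWeaklyRegularSequence R K n) {p : PrimeSpectrum R}
    (hp : IsAssociatedPrime p.asIdeal K) : (n : ℕ∞) ≤ Order.coheight p := by
  obtain ⟨rs, hrs, hreg, rfl⟩ := hK
  induction rs generalizing K p with
  | nil => simp
  | cons y ys ih =>
    obtain ⟨hy, hys⟩ := (isWeaklyRegular_cons_iff ..).1 hreg
    obtain ⟨q, hq, hpq, hyq⟩ := hp.exists_le_quotSMulTop (hrs y (by simp)) hy
    have hyp : y ∉ p.asIdeal := fun hyp ↦ by
      have := Set.mem_biUnion (t := fun p : Ideal R ↦ (p : Set R))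
        (show p.asIdeal ∈ associatedPrimes R K from hp) hyp
      rw [biUnion_associatedPrimes_eq_compl_regular] at this
      exact this hy
    have hlt : p < ⟨q, hq.isPrime⟩ :=
      lt_of_le_of_ne hpq fun h ↦ hyp (h ▸ hyq)
    have := ih (p := ⟨q, hq.isPrime⟩) hq (fun r hr ↦ hrs r (List.mem_cons_of_mem _ hr)) hys
    rw [List.length_cons, Nat.cast_succ]
    exact (add_le_add_left this 1).trans (Order.coheight_add_one_le hlt)

omit [IsNoetherianRing R] [IsLocalRing R] in
lemma coheight_le_supportDim {K : Type*} [AddCommGroup K] [Module R K] {p : PrimeSpectrum R}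
    (hp : p ∈ Module.support R K) : (Order.coheight p : WithBot ℕ∞) ≤ Module.supportDim R K := by
  have : Order.coheight p ≤ Order.coheight (⟨p, hp⟩ : Module.support R K) := by
    refine Order.coheight_le fun s hs ↦ ?_
    have hmem (i) : s i ∈ Module.support R K :=
      Module.mem_support_mono (hs ▸ LTSeries.head_le s i) hp
    let t : LTSeries (Module.support R K) :=
      { length := s.length
        toFun i := ⟨s i, hmem i⟩
        step := s.step }
    exact Order.length_le_coheight (p := t) hs.ge
  exact (WithBot.coe_le_coe.2 this).trans (Order.coheight_le_krullDim _)

lemma HasWeaklyRegularSequence.isSMulRegular {K : Type*} [AddCommGroup K] [Module R K]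
    [Module.Finite R K] {n : ℕ} (hK : HasWeaklyRegularSequence R K n) {x : R}
    (hx : Module.supportDim R (QuotSMulTop x K) < n) : IsSMulRegular K x := by
  by_contra hreg
  have hmem : x ∈ ({r : R | IsSMulRegular K r} : Set R)ᶜ := hreg
  rw [← biUnion_associatedPrimes_eq_compl_regular] at hmem
  obtain ⟨p, hp, hxp⟩ := Set.mem_iUnion₂.1 hmem
  have hp' : IsAssociatedPrime p K := hp
  let P : PrimeSpectrum R := ⟨p, hp'.isPrime⟩
  have hP : P ∈ Module.support R (QuotSMulTop x K) := by
    rw [Module.support_quotSMulTop]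
    refine ⟨Module.mem_support_iff_of_finite.2
      (Submodule.annihilator_top (R := R) (M := K) ▸ hp'.annihilator_le), ?_⟩
    simpa [PrimeSpectrum.mem_zeroLocus] using hxp
  have h1 := (WithBot.coe_le_coe.2 (hK.le_coheight (p := P) hp')).trans
    (coheight_le_supportDim hP)
  exact absurd hx h1.not_gt

lemma supportDim_le_supportDim_quotient_ofList_add_length {K : Type*} [AddCommGroup K]
    [Module R K] [Module.Finite R K] (rs : List R) (hrs : ∀ r ∈ rs, r ∈ maximalIdeal R) :
    Module.supportDim R K ≤
      Module.supportDim R (K ⧸ Ideal.ofList rs • (⊤ : Submodule R K)) + rs.length := by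
  induction rs generalizing K with
  | nil =>
    rw [Ideal.ofList_nil, Submodule.bot_smul]
    simpa using (Module.supportDim_eq_of_equiv (Submodule.quotEquivOfEqBot ⊥ rfl)).ge
  | cons x rs ih =>
    rw [Module.supportDim_eq_of_equiv
      (Submodule.quotOfListConsSMulTopEquivQuotSMulTopInner K x rs), List.length_cons,
      Nat.cast_succ, ← add_assoc]
    exact (Module.supportDim_le_supportDim_quotSMulTop_succ (hrs x (by simp))).trans
      (add_le_add_left (ih fun r hr ↦ hrs r (List.mem_cons_of_mem _ hr)) 1)

/-- If `K` has a weakly regular sequence of length `n`, then every sequence `rs` with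
`dim K / rs K + length rs ≤ n` is weakly regular. -/
lemma HasWeaklyRegularSequence.isWeaklyRegular {K : Type*} [AddCommGroup K] [Module R K]
    [Module.Finite R K] {n : ℕ} (hK : HasWeaklyRegularSequence R K n) (rs : List R)
    (hrs : ∀ r ∈ rs, r ∈ maximalIdeal R)
    (hdim : Module.supportDim R (K ⧸ Ideal.ofList rs • (⊤ : Submodule R K)) + rs.length ≤ n) :
    IsWeaklyRegular K rs := by
  induction rs generalizing K n with
  | nil => exact .nil _ _
  | cons x rs ih =>
    have hxm := hrs x (by simp)
    have hrs' : ∀ r ∈ rs, r ∈ maximalIdeal R := fun r hr ↦ hrs r (List.mem_cons_of_mem _ hr)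
    rw [Module.supportDim_eq_of_equiv
      (Submodule.quotOfListConsSMulTopEquivQuotSMulTopInner K x rs), List.length_cons,
      Nat.cast_succ, ← add_assoc] at hdim
    have hle := (add_le_add_left
      (supportDim_le_supportDim_quotient_ofList_add_length (K := QuotSMulTop x K) rs hrs') 1).trans
      hdim
    have hlt : Module.supportDim R (QuotSMulTop x K) < n := by
      generalize Module.supportDim R (QuotSMulTop x K) = e at hle
      induction e with
      | bot => exact WithBot.bot_lt_coe _
      | coe e =>
        have : e + 1 ≤ (n : ℕ∞) := by exact_mod_cast hle
        have : e < (n : ℕ∞) := ENat.add_one_le_iff (by rintro rfl; simp at this) |>.1 this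
        exact_mod_cast this
    have hx := hK.isSMulRegular hlt
    cases n with
    | zero =>
      have : Module.supportDim R (QuotSMulTop x K) = ⊥ := by
        generalize Module.supportDim R (QuotSMulTop x K) = e at hlt
        induction e with
        | bot => rfl
        | coe e => exact absurd (WithBot.coe_lt_coe.1 hlt) (by simp)
      have := (Module.supportDim_eq_bot_iff_subsingleton ..).1 this
      exact .cons hx ⟨fun i _ ↦ Function.injective_of_subsingleton _⟩
    | succ n =>
      refine .cons hx (ih (hK.quotSMulTop hxm hx) hrs' ?_)
      generalize Module.supportDim R (QuotSMulTop x K ⧸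
        Ideal.ofList rs • (⊤ : Submodule R (QuotSMulTop x K))) = e at hdim ⊢
      induction e with
      | bot => simp
      | coe e =>
        have : e + rs.length + 1 ≤ (n : ℕ∞) + 1 := by exact_mod_cast hdim
        have := (ENat.add_le_add_iff_right (by simp)).1 this
        exact_mod_cast this

omit [IsNoetherianRing R] in
lemma IsCohenMacaulayModule.hasWeaklyRegularSequence {K : Type*} [AddCommGroup K] [Module R K]
    (hK : IsCohenMacaulayModule R K) {d : ℕ}
    (hdim : ringKrullDim (R ⧸ Module.annihilator R K) = d) : HasWeaklyRegularSequence R K d := by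
  have hd : moduleDepth R K = (d : ℕ∞) := WithBot.coe_injective (hK.trans hdim)
  unfold moduleDepth at hd
  set s := {n : ℕ∞ | ∃ rs : List R, (∀ r ∈ rs, r ∈ maximalIdeal R) ∧
    IsWeaklyRegular K rs ∧ (rs.length : ℕ∞) = n} with hs
  have : Nonempty s := ⟨0, [], by simp, .nil _ _, rfl⟩
  have hmem : sSup s ∈ s := ENat.sSup_mem_of_nonempty_of_lt_top (hd ▸ ENat.natCast_lt_top d)
  obtain ⟨rs, hrs, hreg, hlen⟩ := hd ▸ hmem
  exact ⟨rs, hrs, hreg, by exact_mod_cast hlen⟩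

end

/-- **Corollary 5 (second part).** Let `(R, m)` be a commutative Noetherian local ring, `M` a
finitely generated Cohen–Macaulay `R`-module of dimension `d ≥ 1`, and `N` a Cohen–Macaulay
submodule of `M` with `dim N = d`.  Then every `M`-regular sequence of elements of `m` is an
`N`-regular sequence. -/
theorem regular_sequence_of_cohenMacaulay_submodule
    {R : Type*} [CommRing R] [IsNoetherianRing R] [IsLocalRing R]
    (M : Type*) [AddCommGroup M] [Module R M] [Module.Finite R M]
    (d : ℕ) (hd : 1 ≤ d)
    (hdim : ringKrullDim (R ⧸ Module.annihilator R M) = d)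
    (hCM : IsCohenMacaulayModule R M)
    (N : Submodule R M)
    (hCMN : IsCohenMacaulayModule R N)
    (hdimN : ringKrullDim (R ⧸ Module.annihilator R N) = d)
    (rs : List R) (hrs : ∀ r ∈ rs, r ∈ IsLocalRing.maximalIdeal R)
    (hreg : RingTheory.Sequence.IsRegular M rs) :
    RingTheory.Sequence.IsRegular N rs := by
  have : Nontrivial N := by
    refine (Module.supportDim_ne_bot_iff_nontrivial R N).1 ?_
    rw [Module.supportDim_eq_ringKrullDim_quotient_annihilator, hdimN]
    exact WithBot.coe_ne_bot
  have hsupp : Module.supportDim R (N ⧸ Ideal.ofList rs • (⊤ : Submodule R N)) ≤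
      Module.supportDim R (M ⧸ Ideal.ofList rs • (⊤ : Submodule R M)) := by
    refine Order.krullDim_le_of_strictMono (fun p ↦ ⟨p.1, ?_⟩) fun _ _ h ↦ h
    have hp : p.1 ∈ Module.support R N ∩ PrimeSpectrum.zeroLocus (Ideal.ofList rs) :=
      Module.support_quotient (M := N) (Ideal.ofList rs) ▸ p.2
    rw [Module.support_quotient]
    exact ⟨Module.support_subset_of_injective N.subtype N.injective_subtype hp.1, hp.2⟩
  refine (isRegular_iff_isWeaklyRegular_of_subset_maximalIdeal hrs).2
    ((hCMN.hasWeaklyRegularSequence hdimN).isWeaklyRegular rs hrs ?_)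
  have hM := Module.supportDim_add_length_eq_supportDim_of_isRegular rs hreg
  rw [Module.supportDim_eq_ringKrullDim_quotient_annihilator R M, hdim] at hM
  exact (add_le_add_left hsupp _).trans hM.le
end

section
/- Let R be a commutative Noetherian local Cohen–Macaulay ring and M a finitely generated maximal Cohen–Macaulay R-module such that M_P is a free R_P-module of constant rank r for every associated prime P of R. Then M is isomorphic to a submodule of the free module R^r. -/
open IsLocalRing

open scoped Pointwise in
/-- If `x` is regular on `M`, every associated prime of `M` is strictly contained in an associated
prime of `M / xM`. -/
theorem exists_isAssociatedPrime_quotSMulTop_gt {R M : Type*} [CommRing R] [IsNoetherianRing R]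
    [IsLocalRing R] [AddCommGroup M] [Module R M] [Module.Finite R M] {x : R}
    (hx : x ∈ maximalIdeal R) (hreg : IsSMulRegular M x) {P : Ideal R}
    (hP : IsAssociatedPrime P M) : ∃ Q, IsAssociatedPrime Q (QuotSMulTop x M) ∧ P < Q := by
  obtain ⟨-, m, hm⟩ := isAssociatedPrime_iff.mp hP
  have hm0 : m ≠ 0 := by
    rintro rfl
    exact hP.isPrime.ne_top (by rw [hm]; ext; simp [Submodule.mem_colon_singleton])
  let N : Submodule R M := Submodule.torsionBySet R M P
  have hmN : m ∈ N := by
    rw [Submodule.mem_torsionBySet_iff]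
    rintro ⟨a, ha⟩
    rw [SetLike.mem_coe, hm, Submodule.mem_colon_singleton] at ha
    simpa using ha
  obtain ⟨n, hnN, hn⟩ : ∃ n ∈ N, n ∉ x • (⊤ : Submodule R M) := by
    by_contra! hle
    have hN : N ≤ Ideal.span {x} • N := by
      intro n hn
      obtain ⟨n', -, rfl⟩ := (Submodule.mem_smul_pointwise_iff_exists _ _ _).mp (hle n hn)
      refine Submodule.smul_mem_smul (Ideal.mem_span_singleton_self x) ?_
      rw [Submodule.mem_torsionBySet_iff] at hn ⊢
      intro a
      apply hreg
      simpa [smul_comm x] using hn a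
    have hbot : N = ⊥ := Submodule.eq_bot_of_le_smul_of_le_jacobson_bot _ N
      (IsNoetherian.noetherian N) hN (by
        rw [IsLocalRing.jacobson_eq_maximalIdeal ⊥ bot_ne_top, Ideal.span_singleton_le_iff_mem]
        exact hx)
    exact hm0 (by simpa [hbot] using hmN)
  have hn0 : (Submodule.mkQ (x • (⊤ : Submodule R M)) n : QuotSMulTop x M) ≠ 0 := by
    simpa using hn
  obtain ⟨Q, hQ, hle⟩ := exists_le_isAssociatedPrime_of_isNoetherianRing R
    (Submodule.mkQ (x • (⊤ : Submodule R M)) n : QuotSMulTop x M) hn0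
  refine ⟨Q, hQ, lt_of_le_of_ne (fun a ha ↦ hle ?_) ?_⟩
  · have := (Submodule.mem_torsionBySet_iff _ _).mp hnN ⟨a, ha⟩
    rw [Submodule.mem_colon_singleton, ← map_smul]
    simp_all
  · rintro rfl
    have hxP : x ∈ P := hle <| by
      rw [Submodule.mem_colon_singleton, ← map_smul, Submodule.mem_bot, Submodule.mkQ_apply,
        Submodule.Quotient.mk_eq_zero]
      exact Submodule.smul_mem_pointwise_smul _ _ _ trivial
    rw [hm, Submodule.mem_colon_singleton, Submodule.mem_bot] at hxP
    exact hm0 (hreg (by simpa using hxP))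

/-- A weakly regular sequence on `M` in the maximal ideal is no longer than the dimension of `R / P`
for any associated prime `P` of `M`. -/
theorem length_le_coheight_of_isWeaklyRegular {R : Type*} [CommRing R] [IsNoetherianRing R]
    [IsLocalRing R] (rs : List R) : ∀ {M : Type*} [AddCommGroup M] [Module R M] [Module.Finite R M],
    (∀ x ∈ rs, x ∈ maximalIdeal R) → RingTheory.Sequence.IsWeaklyRegular M rs →
    ∀ {P : PrimeSpectrum R}, IsAssociatedPrime P.asIdeal M →
      (rs.length : ℕ∞) ≤ Order.coheight P := by
  induction rs with
  | nil => simp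
  | cons x rs ih =>
    intro M _ _ _ hrs hreg P hP
    rw [RingTheory.Sequence.isWeaklyRegular_cons_iff] at hreg
    obtain ⟨Q, hQ, hlt⟩ := exists_isAssociatedPrime_quotSMulTop_gt (hrs x (by simp)) hreg.1 hP
    have := ih (fun y hy ↦ hrs y (by simp [hy])) hreg.2 (P := ⟨Q, hQ.isPrime⟩) hQ
    rw [List.length_cons, Nat.cast_add, Nat.cast_one]
    exact (add_le_add_left this 1).trans (Order.coheight_add_one_le hlt)

theorem moduleDepth_le_coheight {R M : Type*} [CommRing R] [IsNoetherianRing R] [IsLocalRing R]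
    [AddCommGroup M] [Module R M] [Module.Finite R M] {P : PrimeSpectrum R}
    (hP : IsAssociatedPrime P.asIdeal M) : moduleDepth R M ≤ Order.coheight P := by
  refine sSup_le ?_
  rintro _ ⟨rs, hrs, hreg, rfl⟩
  exact length_le_coheight_of_isWeaklyRegular rs hrs hreg hP

/-- The associated primes of a maximal Cohen–Macaulay module are minimal primes of the ring. -/
theorem IsAssociatedPrime.mem_minimalPrimes_of_moduleDepth_eq {R M : Type*} [CommRing R]
    [IsNoetherianRing R] [IsLocalRing R] [AddCommGroup M] [Module R M] [Module.Finite R M]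
    (hM : (moduleDepth R M : WithBot ℕ∞) = ringKrullDim R) {P : Ideal R}
    (hP : IsAssociatedPrime P M) : P ∈ minimalPrimes R := by
  refine ⟨⟨hP.isPrime, bot_le⟩, fun Q hQ hQP ↦ ?_⟩
  by_contra hPQ
  have hlt : (⟨Q, hQ.1⟩ : PrimeSpectrum R) < ⟨P, hP.isPrime⟩ := lt_of_le_not_ge hQP hPQ
  have h1 : moduleDepth R M ≤ Order.coheight (⟨P, hP.isPrime⟩ : PrimeSpectrum R) :=
    moduleDepth_le_coheight hP
  have h2 : ∀ p : PrimeSpectrum R, Order.coheight p ≤ moduleDepth R M := fun p ↦ by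
    have := Order.coheight_le_krullDim p
    rw [← ringKrullDim, ← hM] at this
    exact_mod_cast this
  have hfin : moduleDepth R M ≠ ⊤ := fun h ↦ ringKrullDim_ne_top (R := R) (by rw [← hM, h]; rfl)
  have h3 := (Order.coheight_add_one_le hlt).trans ((h2 _).trans h1)
  exact absurd h3 (not_le.mpr ((ENat.lt_add_one_iff (ne_top_of_le_ne_top hfin (h2 _))).mpr le_rfl))

/-- A map to `R ^ r` that becomes injective at `P`, for `M` free of rank `r` at `P`. -/
theorem exists_linearMap_pi_of_free_localizedModule {R M : Type*} [CommRing R] [AddCommGroup M]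
    [Module R M] [Module.FinitePresentation R M] (r : ℕ) (P : Ideal R) [P.IsPrime]
    (hfree : Module.Free (Localization.AtPrime P) (LocalizedModule P.primeCompl M))
    (hrank : Module.finrank (Localization.AtPrime P) (LocalizedModule P.primeCompl M) = r) :
    ∃ h : M →ₗ[R] (Fin r → R), ∀ m, (∀ i, algebraMap R (Localization.AtPrime P) (h m i) = 0) →
      LocalizedModule.mkLinearMap P.primeCompl M m = 0 := by
  let b := Module.finBasisOfFinrankEq (Localization.AtPrime P) (LocalizedModule P.primeCompl M)
    hrank
  let e := b.equivFun.restrictScalars R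
  let f : (Fin r → R) →ₗ[R] (Fin r → Localization.AtPrime P) :=
    LinearMap.pi fun i ↦ Algebra.linearMap R (Localization.AtPrime P) ∘ₗ LinearMap.proj i
  obtain ⟨h, s, hs⟩ := Module.FinitePresentation.exists_lift_of_isLocalizedModule P.primeCompl f
    (e.toLinearMap ∘ₗ LocalizedModule.mkLinearMap P.primeCompl M)
  refine ⟨h, fun m hm ↦ e.injective ?_⟩
  rw [map_zero]
  have h1 : f (h m) = 0 := funext hm
  have h2 : s • e (LocalizedModule.mkLinearMap P.primeCompl M m) = s • 0 := by
    rw [smul_zero, ← h1]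
    exact (LinearMap.congr_fun hs m).symm
  exact IsLocalizedModule.smul_injective f s h2

/-- A minimal prime of a Noetherian ring is separated from the others by an element that vanishes
locally at each of them. -/
theorem exists_notMem_algebraMap_atPrime_eq_zero {R : Type*} [CommRing R] [IsNoetherianRing R]
    {P : Ideal R} (hP : P ∈ minimalPrimes R) :
    ∃ t ∉ P, ∀ (Q : Ideal R) [Q.IsPrime], Q ∈ minimalPrimes R → Q ≠ P →
      algebraMap R (Localization.AtPrime Q) t = 0 := by
  have hPp : P.IsPrime := hP.1.1
  have key : ∀ Q : Ideal R, ∃ t ∉ P, ∀ [Q.IsPrime], Q ∈ minimalPrimes R → Q ≠ P →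
      algebraMap R (Localization.AtPrime Q) t = 0 := by
    intro Q
    by_cases hQ : Q ∈ minimalPrimes R ∧ Q ≠ P
    · have : Q.IsPrime := hQ.1.1.1
      obtain ⟨a, haQ, haP⟩ := SetLike.not_le_iff_exists.mp
        fun hle : Q ≤ P ↦ hQ.2 (le_antisymm hle (hP.2 ⟨this, bot_le⟩ hle))
      have : Ring.KrullDimLE 0 (Localization.AtPrime Q) := .of_isLocalization _ hQ.1 _
      obtain ⟨n, hn⟩ := (Ring.KrullDimLE.isNilpotent_iff_mem_maximalIdeal
        (x := algebraMap R (Localization.AtPrime Q) a)).mpr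
        ((IsLocalization.AtPrime.to_map_mem_maximal_iff _ Q a).mpr haQ)
      exact ⟨a ^ n, fun h ↦ haP (hPp.mem_of_pow_mem n h), fun _ _ ↦ by rw [map_pow, hn]⟩
    · exact ⟨1, hPp.one_notMem, fun h1 h2 ↦ absurd ⟨h1, h2⟩ hQ⟩
  choose t htP ht using key
  have hfin : (minimalPrimes R).Finite := minimalPrimes.finite_of_isNoetherianRing R
  refine ⟨∏ Q ∈ hfin.toFinset, t Q, ?_, fun Q _ hQ hne ↦ ?_⟩
  · rw [hPp.prod_mem_iff]
    rintro ⟨Q, -, hQ⟩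
    exact htP Q hQ
  · rw [map_prod]
    exact Finset.prod_eq_zero (hfin.mem_toFinset.mpr hQ) (ht Q hQ hne)

/-- Let `R` be a commutative Noetherian local Cohen–Macaulay ring (`depth R = dim R`) and `M`
a finitely generated maximal Cohen–Macaulay `R`-module (`depth M = dim R`) such that `M_P` is
a free `R_P`-module of constant rank `r` for every associated prime `P` of `R`.  Then `M` is
isomorphic to a submodule of the free module `R^r`, i.e. there is an injective `R`-linear map
`M →ₗ[R] R^r`. -/
theorem exists_embedding_into_free_of_maximal_cohenMacaulay
    {R : Type*} [CommRing R] [IsNoetherianRing R] [IsLocalRing R]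
    (hCMR : (moduleDepth R R : WithBot ℕ∞) = ringKrullDim R)
    (M : Type*) [AddCommGroup M] [Module R M] [Module.Finite R M]
    (hMCM : (moduleDepth R M : WithBot ℕ∞) = ringKrullDim R)
    (r : ℕ)
    (hfree : ∀ (P : Ideal R) [P.IsPrime], P ∈ associatedPrimes R R →
      Module.Free (Localization.AtPrime P) (LocalizedModule P.primeCompl M) ∧
        Module.finrank (Localization.AtPrime P) (LocalizedModule P.primeCompl M) = r) :
    ∃ f : M →ₗ[R] (Fin r → R), Function.Injective f := by
  have hmin : ∀ P ∈ minimalPrimes R, ∃ h : M →ₗ[R] (Fin r → R), ∃ t ∉ P,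
      (∀ (Q : Ideal R) [Q.IsPrime], Q ∈ minimalPrimes R → Q ≠ P →
        algebraMap R (Localization.AtPrime Q) t = 0) ∧
      ∀ [P.IsPrime] (m : M), (∀ i, algebraMap R (Localization.AtPrime P) (h m i) = 0) →
        LocalizedModule.mkLinearMap P.primeCompl M m = 0 := by
    intro P hP
    have : P.IsPrime := hP.1.1
    have hass : P ∈ associatedPrimes R R :=
      Module.associatedPrimes.minimalPrimes_annihilator_subset_associatedPrimes R R (by
        rwa [Module.annihilator_eq_bot.mpr inferInstance])
    have : Module.FinitePresentation R M := Module.finitePresentation_of_finite R M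
    obtain ⟨h, hh⟩ := exists_linearMap_pi_of_free_localizedModule r P (hfree P hass).1
      (hfree P hass).2
    obtain ⟨t, htP, ht⟩ := exists_notMem_algebraMap_atPrime_eq_zero hP
    exact ⟨h, t, htP, ht, fun m hm ↦ hh m hm⟩
  choose! h t htP ht hh using hmin
  have hfin : (minimalPrimes R).Finite := minimalPrimes.finite_of_isNoetherianRing R
  let f : M →ₗ[R] (Fin r → R) := ∑ P ∈ hfin.toFinset, t P • h P
  refine ⟨f, LinearMap.ker_eq_bot.mp (not_not.mp fun hne ↦ ?_)⟩
  have : Nontrivial (LinearMap.ker f) := Submodule.nontrivial_iff_ne_bot.mpr hne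
  obtain ⟨P, hP⟩ := associatedPrimes.nonempty R (LinearMap.ker f)
  have hPp : P.IsPrime := hP.isPrime
  have hPmin : P ∈ minimalPrimes R :=
    (hP.map_of_injective (LinearMap.ker f).subtype
      (LinearMap.ker f).injective_subtype).mem_minimalPrimes_of_moduleDepth_eq hMCM
  obtain ⟨-, ⟨m, hmf⟩, hm⟩ := isAssociatedPrime_iff.mp hP
  have hm0 : LocalizedModule.mkLinearMap P.primeCompl M m = 0 := by
    refine hh P hPmin m fun i ↦ ?_
    have hsum : algebraMap R (Localization.AtPrime P) (f m i) =
        algebraMap R (Localization.AtPrime P) (t P * h P m i) := by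
      simp only [f, LinearMap.sum_apply, Finset.sum_apply, map_sum]
      refine Finset.sum_eq_single_of_mem P (hfin.mem_toFinset.mpr hPmin) fun Q hQ hQP ↦ ?_
      simp [ht Q (hfin.mem_toFinset.mp hQ) P hPmin hQP.symm]
    rw [LinearMap.mem_ker.mp hmf, Pi.zero_apply, map_zero, map_mul] at hsum
    exact ((IsLocalization.map_units (Localization.AtPrime P)
      (⟨t P, htP P hPmin⟩ : P.primeCompl)).mul_right_eq_zero).mp hsum.symm
  obtain ⟨s, hs⟩ := (IsLocalizedModule.eq_zero_iff P.primeCompl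
    (LocalizedModule.mkLinearMap P.primeCompl M)).mp hm0
  exact s.2 (hm.ge (Submodule.mem_colon_singleton.mpr
    ((Submodule.mem_bot R).mpr (Subtype.ext hs))))
end
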